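/- arXiv:1407.2801 — 2 statements merged into one kernel-verified Lean document; each statement's English description precedes it below -/
import Mathlib

section
/- Let A be an n×n Robinson similarity matrix and let B be an n×n Toeplitz Robinson dissimilarity matrix with zero diagonal. Then for every permutation π of [n], ⟨A_π, B⟩ ≥ ⟨A, B⟩; that is, the identity permutation is optimal for QAP(A,B). -/
/-- `A` is a Robinson similarity matrix: it is symmetric and its entries decrease
monotonically in rows and columns when moving away from the main diagonal, i.e.
`A i k ≤ min (A i j) (A j k)` for all `i ≤ j ≤ k`. -/
def IsRobinsonSim {n : ℕ} (A : Matrix (Fin n) (Fin n) ℝ) : Prop :=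
  (∀ i j, A i j = A j i) ∧
  ∀ i j k : Fin n, i ≤ j → j ≤ k → A i k ≤ min (A i j) (A j k)

/-- `B` is a Robinson dissimilarity matrix: it is symmetric and
`max (B i j) (B j k) ≤ B i k` for all `i ≤ j ≤ k`. -/
def IsRobinsonDissim {n : ℕ} (B : Matrix (Fin n) (Fin n) ℝ) : Prop :=
  (∀ i j, B i j = B j i) ∧
  ∀ i j k : Fin n, i ≤ j → j ≤ k → max (B i j) (B j k) ≤ B i k

/-- `A` is a Toeplitz matrix: `A i j = A (i+1) (j+1)` whenever the indices make sense. -/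
def IsToeplitz {n : ℕ} (A : Matrix (Fin n) (Fin n) ℝ) : Prop :=
  ∀ (i j : Fin n) (hi : i.val + 1 < n) (hj : j.val + 1 < n),
    A i j = A ⟨i.val + 1, hi⟩ ⟨j.val + 1, hj⟩

/-- The matrix `A_π` with entries `(A_π) i j = A (π i) (π j)`. -/
def permMat {n : ℕ} (A : Matrix (Fin n) (Fin n) ℝ) (π : Equiv.Perm (Fin n)) :
    Matrix (Fin n) (Fin n) ℝ :=
  Matrix.of fun i j => A (π i) (π j)

/-- The trace inner product `⟨A,B⟩ = ∑_{i,j} A i j * B i j`. -/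
def mInner {n : ℕ} (A B : Matrix (Fin n) (Fin n) ℝ) : ℝ :=
  ∑ i, ∑ j, A i j * B i j

/-- The 0/1 Toeplitz Robinson dissimilarity matrix `B^Δ_n`, with `(i,j)` entry `1`
iff `|i - j| ≥ n - Δ` (indices thought of as `1,…,n`, here `0`-based). -/
def BDelta (n Δ : ℕ) : Matrix (Fin n) (Fin n) ℝ :=
  Matrix.of fun i j => if (n : ℤ) - (Δ : ℤ) ≤ |(i.val : ℤ) - (j.val : ℤ)| then 1 else 0

/-- The set `E^Δ_n` of (unordered, represented here with first coordinate smaller)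
upper-triangular support positions of `B^Δ_n`: the pairs `(i,j)` with `i < j` and
`j - i ≥ n - Δ`, i.e. `i + (n - Δ) ≤ j`. -/
def EDelta (n Δ : ℕ) : Finset (Fin n × Fin n) :=
  Finset.univ.filter (fun p => p.1.val + (n - Δ) ≤ p.2.val)

/-- Sum of `k` values of a nonnegative antitone function is at most the sum of the first `k`. -/
lemma qap_topk {n : ℕ} (f : Fin n → ℝ) (hf0 : ∀ i, 0 ≤ f i) (hf : Antitone f)
    (T : Finset (Fin n)) (k : ℕ) (hT : T.card ≤ k) :
    ∑ i ∈ T, f i ≤ ∑ i : Fin n, if i.val < k then f i else 0 := by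
  rcases Nat.lt_or_ge k n with hk | hk
  · have e1 : ∑ i ∈ T, (f i - f ⟨k, hk⟩) ≤
        ∑ i ∈ Finset.univ.filter (fun i : Fin n => i.val < k), (f i - f ⟨k, hk⟩) := by
      rw [← Finset.sum_filter_add_sum_filter_not T (fun i : Fin n => i.val < k)]
      have h1 : ∑ i ∈ T.filter (fun i : Fin n => ¬ i.val < k), (f i - f ⟨k, hk⟩) ≤ 0 := by
        apply Finset.sum_nonpos
        intro i hi
        have := (Finset.mem_filter.1 hi).2
        have h2 : f i ≤ f ⟨k, hk⟩ := hf (Fin.mk_le_of_le_val (by omega))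
        linarith
      have h3 : ∑ i ∈ T.filter (fun i : Fin n => i.val < k), (f i - f ⟨k, hk⟩) ≤
          ∑ i ∈ Finset.univ.filter (fun i : Fin n => i.val < k), (f i - f ⟨k, hk⟩) := by
        apply Finset.sum_le_sum_of_subset_of_nonneg
        · exact Finset.filter_subset_filter _ (Finset.subset_univ _)
        · intro i hi _
          have := (Finset.mem_filter.1 hi).2
          have h2 : f ⟨k, hk⟩ ≤ f i := hf (Fin.le_def.2 (by simpa using this.le))
          linarith
      linarith
    have hc : (Finset.univ.filter (fun i : Fin n => i.val < k)).card = k := by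
      rw [Fin.card_filter_val_lt]; omega
    rw [Finset.sum_sub_distrib, Finset.sum_sub_distrib, Finset.sum_const, Finset.sum_const, hc,
      nsmul_eq_mul, nsmul_eq_mul] at e1
    rw [← Finset.sum_filter]
    have : (T.card : ℝ) ≤ k := by exact_mod_cast hT
    nlinarith [hf0 ⟨k, hk⟩]
  · have : ∀ i : Fin n, (if i.val < k then f i else 0) = f i := by
      intro i; rw [if_pos]; omega
    simp only [this]
    exact Finset.sum_le_sum_of_subset_of_nonneg (Finset.subset_univ _) (fun i _ _ => hf0 i)

/-- Pairing positions at distance `k` across the gap `p`. -/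
lemma qap_comb {n : ℕ} (p k : ℕ) (c : Fin n → ℝ) (hc : ∀ i, 0 ≤ c i) :
    ∃ S : Finset (Fin n), S.card ≤ k ∧
      (∑ i : Fin n, if p ≤ i.val + k ∧ i.val < p + k then c i else 0) ≤
      ∑ i ∈ S, c i +
      ∑ i : Fin n, ∑ j : Fin n,
        if i.val < p ∧ p ≤ j.val ∧ j.val = i.val + k then min (c i) (c j) else 0 := by
  classical
  set N := Finset.univ.filter (fun i : Fin n => p ≤ i.val + k ∧ i.val < p + k) with hN
  set Q := Finset.univ.filter
    (fun q : Fin n × Fin n => q.1.val < p ∧ p ≤ q.2.val ∧ q.2.val = q.1.val + k) with hQ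
  let h : Fin n × Fin n → Fin n := fun q => if c q.1 < c q.2 then q.1 else q.2
  have hmin : ∀ q, c (h q) = min (c q.1) (c q.2) := by
    intro q
    by_cases hq : c q.1 < c q.2
    · simp [h, hq, hq.le]
    · simp [h, hq, not_lt.1 hq]
  refine ⟨N \ Q.image h, ?_, ?_⟩
  · rcases Nat.eq_zero_or_pos k with rfl | hk
    · have : N = ∅ := by
        apply Finset.filter_eq_empty_iff.2
        intro i _; omega
      simp [this]
    have key : ∀ i ∈ N \ Q.image h, ∀ j ∈ N \ Q.image h,
        i.val % k = j.val % k → i.val < j.val → False := by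
      intro i hi j hj hij hlt
      rw [Finset.mem_sdiff] at hi hj
      have hi1 := (Finset.mem_filter.1 hi.1).2
      have hj1 := (Finset.mem_filter.1 hj.1).2
      have hd : k ∣ j.val - i.val := (Nat.modEq_iff_dvd' hlt.le).1 hij
      obtain ⟨t, ht⟩ := hd
      have ht1 : t = 1 := by
        have : t < 2 := by
          by_contra hcon
          have : k * 2 ≤ k * t := Nat.mul_le_mul_left k (by omega)
          omega
        have : t ≠ 0 := by rintro rfl; omega
        omega
      subst ht1
      have hq : (i, j) ∈ Q := by
        rw [hQ, Finset.mem_filter]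
        refine ⟨Finset.mem_univ _, ?_, ?_, ?_⟩ <;> simp only <;> omega
      have hm := Finset.mem_image_of_mem h hq
      by_cases hcc : c i < c j
      · have : h (i, j) = i := by simp [h, hcc]
        exact hi.2 (this ▸ hm)
      · have : h (i, j) = j := by simp [h, hcc]
        exact hj.2 (this ▸ hm)
    have hinj : Set.InjOn (fun i : Fin n => i.val % k) (N \ Q.image h : Finset (Fin n)) := by
      intro i hi j hj hij
      rcases lt_trichotomy i.val j.val with hlt | heq | hlt
      · exact (key i hi j hj hij hlt).elim
      · exact Fin.ext heq
      · exact (key j hj i hi hij.symm hlt).elim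
    have := Finset.card_le_card_of_injOn (t := Finset.range k) _
      (fun i _ => Finset.mem_coe.2 (Finset.mem_range.2 (Nat.mod_lt _ hk))) hinj
    simpa using this
  · have e1 : (∑ i : Fin n, ∑ j : Fin n,
        if i.val < p ∧ p ≤ j.val ∧ j.val = i.val + k then min (c i) (c j) else 0)
        = ∑ q ∈ Q, c (h q) := by
      rw [hQ, Finset.sum_filter, Fintype.sum_prod_type]
      simp only [hmin]
    have e2 : ∑ i ∈ Q.image h, c i ≤ ∑ q ∈ Q, c (h q) :=
      Finset.sum_image_le_of_nonneg (fun i _ => hc i)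
    rw [e1, ← Finset.sum_filter]
    have e3 : ∑ i ∈ N, c i ≤ ∑ i ∈ (N \ Q.image h) ∪ Q.image h, c i := by
      apply Finset.sum_le_sum_of_subset_of_nonneg
      · rw [Finset.sdiff_union_self_eq_union]; exact Finset.subset_union_left
      · intro i _ _; exact hc i
    rw [Finset.sum_union Finset.sdiff_disjoint] at e3
    linarith

/-- Main induction, for nonnegative `A`. -/
lemma qap_main (k : ℕ) : ∀ (n : ℕ) (A : Fin n → Fin n → ℝ)
    (_ : ∀ i j, A i j = A j i) (_ : ∀ i j, 0 ≤ A i j)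
    (_ : ∀ i j l : Fin n, i ≤ j → j ≤ l → A i l ≤ min (A i j) (A j l))
    (x : Fin n → Fin n) (_ : Function.Injective x),
    (∑ i : Fin n, ∑ j : Fin n, if i.val < j.val ∧ j.val ≤ i.val + k then A (x i) (x j) else 0) ≤
    ∑ i : Fin n, ∑ j : Fin n, if i.val < j.val ∧ j.val ≤ i.val + k then A i j else 0 := by
  intro n
  induction n with
  | zero => intros; simp
  | succ n ih =>
    intro A hs h0 hR x hx
    obtain ⟨p, hp⟩ := (Finite.injective_iff_surjective.1 hx) 0
    have hne : ∀ i, x (p.succAbove i) ≠ 0 := by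
      intro i hi
      exact Fin.succAbove_ne p i (hx (hi.trans hp.symm))
    set y : Fin n → Fin n := fun i => (x (p.succAbove i)).pred (hne i) with hy
    have hys : ∀ i, x (p.succAbove i) = (y i).succ := by intro i; simp [hy]
    have hyinj : Function.Injective y := by
      intro i j hij
      have : x (p.succAbove i) = x (p.succAbove j) := by rw [hys, hys, hij]
      exact Fin.succAbove_right_injective (hx this)
    have ih' := ih (fun i j => A i.succ j.succ) (fun i j => hs _ _) (fun i j => h0 _ _)
      (fun i j l hij hjl => hR _ _ _ (Fin.succ_le_succ_iff.2 hij) (Fin.succ_le_succ_iff.2 hjl))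
      y hyinj
    have hval : ∀ i : Fin n, (p.succAbove i).val = if i.val < p.val then i.val else i.val + 1 := by
      intro i
      by_cases h : i.val < p.val
      · rw [Fin.succAbove_of_castSucc_lt _ _ (by simpa [Fin.lt_def] using h)]; simp [h]
      · rw [Fin.succAbove_of_le_castSucc _ _ (by simpa [Fin.le_def] using h)]; simp [h]
    set c : Fin n → ℝ := fun i => A 0 (y i).succ with hcdef
    obtain ⟨S, hS, hcomb⟩ := qap_comb p.val k c (fun i => h0 _ _)
    have htop := qap_topk (fun i : Fin n => A 0 i.succ) (fun i => h0 _ _)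
      (fun i j hij => (hR 0 i.succ j.succ (Fin.zero_le _) (Fin.succ_le_succ_iff.2 hij)).trans
        (min_le_left _ _)) (S.image y) k (Finset.card_image_le.trans hS)
    rw [Finset.sum_image (fun i _ j _ h => hyinj h)] at htop
    have hgain : (∑ i : Fin n, ∑ j : Fin n,
        if i.val < p.val ∧ p.val ≤ j.val ∧ j.val = i.val + k then min (c i) (c j) else 0) ≤
        ∑ i : Fin n, ∑ j : Fin n,
        if i.val < p.val ∧ p.val ≤ j.val ∧ j.val = i.val + k
          then A (y i).succ (y j).succ else 0 := by
      refine Finset.sum_le_sum fun i _ => Finset.sum_le_sum fun j _ => ?_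
      split_ifs
      · rcases le_total (y i) (y j) with h | h
        · exact (min_le_right _ _).trans ((hR 0 (y i).succ (y j).succ (Fin.zero_le _)
            (Fin.succ_le_succ_iff.2 h)).trans (min_le_right _ _))
        · rw [hs (y i).succ]
          exact (min_le_left _ _).trans ((hR 0 (y j).succ (y i).succ (Fin.zero_le _)
            (Fin.succ_le_succ_iff.2 h)).trans (min_le_right _ _))
      · exact le_rfl
    have hsplit : (∑ i : Fin n, ∑ j : Fin n,
        if i.val < j.val ∧ j.val ≤ i.val + k then A (y i).succ (y j).succ else 0) =
        (∑ i : Fin n, ∑ j : Fin n,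
        if (p.succAbove i).val < (p.succAbove j).val ∧
          (p.succAbove j).val ≤ (p.succAbove i).val + k then A (y i).succ (y j).succ else 0) +
        ∑ i : Fin n, ∑ j : Fin n,
        if i.val < p.val ∧ p.val ≤ j.val ∧ j.val = i.val + k
          then A (y i).succ (y j).succ else 0 := by
      simp only [← Finset.sum_add_distrib]
      refine Finset.sum_congr rfl fun i _ => Finset.sum_congr rfl fun j _ => ?_
      simp only [hval]
      split_ifs <;> first | (exfalso; omega) | simp
    have hL : (∑ i : Fin (n+1), ∑ j : Fin (n+1),
        if i.val < j.val ∧ j.val ≤ i.val + k then A (x i) (x j) else 0) =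
        (∑ i : Fin n, if p.val ≤ i.val + k ∧ i.val < p.val + k then c i else 0) +
        (∑ i : Fin n, ∑ j : Fin n,
        if (p.succAbove i).val < (p.succAbove j).val ∧
          (p.succAbove j).val ≤ (p.succAbove i).val + k
          then A (y i).succ (y j).succ else 0) := by
      rw [Fin.sum_univ_succAbove _ p, Fin.sum_univ_succAbove _ p]
      simp only [Fin.sum_univ_succAbove _ p, Finset.sum_add_distrib, hys, hp]
      simp only [lt_irrefl, false_and, if_false, zero_add]
      rw [← add_assoc, ← Finset.sum_add_distrib]
      congr 1
      refine Finset.sum_congr rfl fun i _ => ?_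
      simp only [hval, hs _ 0, hcdef]
      split_ifs <;> first | (exfalso; omega) | simp
    have hRr : (∑ i : Fin (n+1), ∑ j : Fin (n+1),
        if i.val < j.val ∧ j.val ≤ i.val + k then A i j else 0) =
        (∑ i : Fin n, if i.val < k then A 0 i.succ else 0) +
        (∑ i : Fin n, ∑ j : Fin n,
        if i.val < j.val ∧ j.val ≤ i.val + k then A i.succ j.succ else 0) := by
      simp only [Fin.sum_univ_succ, Fin.val_zero, Fin.val_succ]
      simp only [lt_irrefl, false_and, if_false, zero_add, Nat.not_lt_zero]
      congr 1
      · refine Finset.sum_congr rfl fun i _ => ?_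
        refine if_congr (by omega) rfl rfl
      · refine Finset.sum_congr rfl fun i _ => Finset.sum_congr rfl fun j _ => ?_
        refine if_congr (by omega) rfl rfl
    rw [hL, hRr]
    rw [hsplit] at ih'
    have : ∑ i ∈ S, A 0 (y i).succ = ∑ i ∈ S, c i := rfl
    linarith

/-- Symmetric version, for arbitrary `A`. -/
lemma qap_sym {n : ℕ} (k : ℕ) (A : Fin n → Fin n → ℝ)
    (hs : ∀ i j, A i j = A j i)
    (hR : ∀ i j l : Fin n, i ≤ j → j ≤ l → A i l ≤ min (A i j) (A j l))
    (π : Equiv.Perm (Fin n)) :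
    (∑ i : Fin n, ∑ j : Fin n,
      if i.val ≤ j.val + k ∧ j.val ≤ i.val + k then A (π i) (π j) else 0) ≤
    ∑ i : Fin n, ∑ j : Fin n,
      if i.val ≤ j.val + k ∧ j.val ≤ i.val + k then A i j else 0 := by
  obtain ⟨C, hC⟩ : ∃ C : ℝ, ∀ i j, 0 ≤ A i j + C := by
    refine ⟨∑ i, ∑ j, |A i j|, fun i j => ?_⟩
    have h1 : |A i j| ≤ ∑ j, |A i j| :=
      Finset.single_le_sum (f := fun j => |A i j|) (fun j _ => abs_nonneg _) (Finset.mem_univ j)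
    have h2 : ∑ j, |A i j| ≤ ∑ i, ∑ j, |A i j| :=
      Finset.single_le_sum (f := fun i => ∑ j, |A i j|)
        (fun i _ => Finset.sum_nonneg fun j _ => abs_nonneg _) (Finset.mem_univ i)
    linarith [neg_abs_le (A i j)]
  have hm := qap_main k n (fun i j => A i j + C) (fun i j => by simp only [hs i j])
    hC (fun i j l hij hjl => by
      have := le_min_iff.1 (hR i j l hij hjl)
      exact le_min (by linarith [this.1]) (by linarith [this.2])) π π.injective
  have hspl : ∀ M : Fin n → Fin n → ℝ, (∑ i : Fin n, ∑ j : Fin n,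
      if i.val < j.val ∧ j.val ≤ i.val + k then M i j + C else 0) =
      (∑ i : Fin n, ∑ j : Fin n, if i.val < j.val ∧ j.val ≤ i.val + k then M i j else 0) +
      ∑ i : Fin n, ∑ j : Fin n, if i.val < j.val ∧ j.val ≤ i.val + k then C else 0 := by
    intro M
    simp only [← Finset.sum_add_distrib]
    refine Finset.sum_congr rfl fun i _ => Finset.sum_congr rfl fun j _ => ?_
    split_ifs <;> simp
  rw [hspl A, hspl (fun i j => A (π i) (π j))] at hm
  have hsym : ∀ M : Fin n → Fin n → ℝ, (∀ i j, M i j = M j i) → (∑ i : Fin n, ∑ j : Fin n,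
      if i.val ≤ j.val + k ∧ j.val ≤ i.val + k then M i j else 0) =
      2 * (∑ i : Fin n, ∑ j : Fin n, if i.val < j.val ∧ j.val ≤ i.val + k then M i j else 0) +
      ∑ i : Fin n, M i i := by
    intro M hM
    have e1 : (∑ i : Fin n, ∑ j : Fin n, if i.val < j.val ∧ j.val ≤ i.val + k then M i j else 0)
      = ∑ i : Fin n, ∑ j : Fin n, if j.val < i.val ∧ i.val ≤ j.val + k then M i j else 0 := by
      rw [Finset.sum_comm]
      refine Finset.sum_congr rfl fun i _ => Finset.sum_congr rfl fun j _ => ?_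
      rw [hM i j]
    have e2 : ∑ i : Fin n, M i i = ∑ i : Fin n, ∑ j : Fin n, if i = j then M i j else 0 := by
      simp
    rw [two_mul]
    nth_rewrite 2 [e1]
    rw [e2]
    simp only [← Finset.sum_add_distrib]
    refine Finset.sum_congr rfl fun i _ => Finset.sum_congr rfl fun j _ => ?_
    simp only [Fin.ext_iff]
    split_ifs <;> first | (exfalso; omega) | simp
  rw [hsym A hs, hsym (fun i j => A (π i) (π j)) (fun i j => hs _ _)]
  have hd : ∑ i, A (π i) (π i) = ∑ i, A i i := Equiv.sum_comp π (fun i => A i i)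
  rw [hd]
  linarith

lemma qap_tele (f : ℕ → ℝ) (d m : ℕ) (h : d ≤ m) :
    f d = f m - ∑ k ∈ Finset.range m, if d ≤ k then f (k + 1) - f k else 0 := by
  induction m, h using Nat.le_induction with
  | base =>
    rw [Finset.sum_eq_zero]
    · simp
    · intro k hk
      rw [if_neg]; have := Finset.mem_range.1 hk; omega
  | succ m hm ih =>
    rw [Finset.sum_range_succ, if_pos hm]; linarith

/-- if `A` is a Robinson similarity and `B` is a Toeplitz Robinson
dissimilarity with zero diagonal, then `⟨A_π, B⟩ ≥ ⟨A, B⟩` for every permutation `π`. -/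
theorem identity_optimal_QAP_toeplitzB {n : ℕ}
    (A B : Matrix (Fin n) (Fin n) ℝ)
    (hA : IsRobinsonSim A) (hB : IsRobinsonDissim B) (hBT : IsToeplitz B)
    (hBdiag : ∀ i, B i i = 0) (π : Equiv.Perm (Fin n)) :
    mInner (permMat A π) B ≥ mInner A B := by
  obtain ⟨hs, hR⟩ := hA
  obtain ⟨hBs, hBR⟩ := hB
  rcases n with _ | m
  · simp [mInner]
  set f : ℕ → ℝ := fun d => B 0 ⟨min d m, by omega⟩ with hf
  have hshift : ∀ t d (h : t + d < m + 1), B ⟨t, by omega⟩ ⟨t + d, h⟩ = f d := by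
    intro t
    induction t with
    | zero =>
      intro d h
      simp only [hf]
      congr 1
      ext; simp; omega
    | succ t ih =>
      intro d h
      rw [← ih d (by omega), hBT ⟨t, by omega⟩ ⟨t + d, by omega⟩ (by simp only; omega)
        (by simp only; omega)]
      congr 1
      ext; simp only; omega
  have hmono : ∀ k, f k ≤ f (k + 1) := by
    intro k
    exact (le_max_left _ _).trans (hBR 0 ⟨min k m, by omega⟩ ⟨min (k+1) m, by omega⟩
      (Fin.zero_le _) (Fin.mk_le_mk.2 (by omega)))
  have hBf : ∀ i j : Fin (m+1), B i j = f m -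
      ∑ k ∈ Finset.range m, if i.val ≤ j.val + k ∧ j.val ≤ i.val + k
        then f (k + 1) - f k else 0 := by
    have key : ∀ i j : Fin (m+1), i ≤ j → B i j = f m -
      ∑ k ∈ Finset.range m, if i.val ≤ j.val + k ∧ j.val ≤ i.val + k
        then f (k + 1) - f k else 0 := by
      intro i j hij
      have hij' : i.val ≤ j.val := hij
      have h1 := hshift i.val (j.val - i.val) (by omega)
      have h2 : (⟨i.val + (j.val - i.val), by omega⟩ : Fin (m+1)) = j := by ext; simp only; omega
      rw [h2] at h1
      have h1' : B i j = f (j.val - i.val) := h1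
      rw [h1', qap_tele f (j.val - i.val) m (by omega)]
      congr 1
      refine Finset.sum_congr rfl fun k _ => if_congr (by omega) rfl rfl
    intro i j
    rcases le_total i j with h | h
    · exact key i j h
    · rw [hBs, key j i h]
      congr 1
      refine Finset.sum_congr rfl fun k _ => if_congr and_comm rfl rfl
  have hform : ∀ M : Fin (m+1) → Fin (m+1) → ℝ, ∑ i, ∑ j, M i j * B i j =
      (∑ i, ∑ j, M i j) * f m - ∑ k ∈ Finset.range m, (f (k + 1) - f k) *
        ∑ i : Fin (m+1), ∑ j : Fin (m+1),
          if i.val ≤ j.val + k ∧ j.val ≤ i.val + k then M i j else 0 := by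
    intro M
    simp only [hBf, mul_sub, Finset.sum_sub_distrib, Finset.mul_sum, Finset.sum_mul]
    congr 1
    symm
    rw [Finset.sum_comm]
    refine Finset.sum_congr rfl fun i _ => ?_
    rw [Finset.sum_comm]
    refine Finset.sum_congr rfl fun j _ => Finset.sum_congr rfl fun k _ => ?_
    split_ifs <;> ring
  have hsum : ∑ i, ∑ j, A (π i) (π j) = ∑ i, ∑ j, A i j := by
    rw [← Equiv.sum_comp π (fun i => ∑ j, A i j)]
    exact Finset.sum_congr rfl fun i _ => Equiv.sum_comp π (fun j => A (π i) j)
  have e1 : mInner (permMat A π) B = ∑ i, ∑ j, A (π i) (π j) * B i j := rfl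
  have e2 : mInner A B = ∑ i, ∑ j, A i j * B i j := rfl
  rw [e1, e2, hform (fun i j => A (π i) (π j)), hform (fun i j => A i j), hsum]
  apply sub_le_sub_left
  refine Finset.sum_le_sum fun k _ => ?_
  exact mul_le_mul_of_nonneg_left (qap_sym k (fun i j => A i j) hs hR π)
    (sub_nonneg.2 (hmono k))
end

section
/- Let A be an n×n Robinson similarity matrix and let p ≥ 1 be a real number. Then the identity permutation is optimal for the p-SUM problem on A; that is, for every permutation π of [n], ∑_{i,j=1}^n A_{π(i)π(j)} |i−j|^p ≥ ∑_{i,j=1}^n A_{ij} |i−j|^p. -/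
/-- The p-SUM objective `∑_{i,j} A (π i) (π j) |i - j| ^ p` (real exponent). -/
noncomputable def pSum {n : ℕ} (A : Matrix (Fin n) (Fin n) ℝ) (p : ℝ)
    (π : Equiv.Perm (Fin n)) : ℝ :=
  ∑ i, ∑ j, A (π i) (π j) * |(i.val : ℝ) - (j.val : ℝ)| ^ p


theorem aux_top {n k : ℕ} (g : Fin n → ℝ) (hg : Antitone g) (h0 : ∀ i, 0 ≤ g i)
    (T : Finset (Fin n)) (hT : T.card ≤ k) :
    ∑ i ∈ T, g i ≤ ∑ j : Fin n, if j.val < k then g j else 0 := by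
  by_cases hk : k < n
  · set c := g ⟨k, hk⟩ with hc
    have h1 : ∑ i ∈ T, (g i - c) ≤ ∑ j : Fin n, if j.val < k then g j - c else 0 := by
      have e : ∑ i ∈ T, (g i - c) = ∑ j : Fin n, if j ∈ T then g j - c else 0 := by
        rw [Finset.sum_ite_mem, Finset.univ_inter]
      rw [e]
      refine Finset.sum_le_sum fun j _ => ?_
      by_cases hj : j.val < k
      · have : c ≤ g j := hg (Fin.le_def.2 hj.le)
        split_ifs <;> linarith
      · have : g j ≤ c := hg (Fin.le_def.2 (not_lt.1 hj))
        rw [if_neg hj]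
        split_ifs <;> linarith
    have h2 : (∑ j : Fin n, if j.val < k then g j - c else 0)
        = (∑ j : Fin n, if j.val < k then g j else 0) - k * c := by
      rw [← Finset.sum_filter, ← Finset.sum_filter, Finset.sum_sub_distrib, Finset.sum_const]
      have : (Finset.univ.filter fun j : Fin n => j.val < k).card = k := by
        rw [Fin.card_filter_val_lt]
        exact min_eq_right hk.le
      rw [this, nsmul_eq_mul]
    rw [h2, Finset.sum_sub_distrib, Finset.sum_const, nsmul_eq_mul] at h1
    have h3 : (T.card : ℝ) * c ≤ k * c :=
      mul_le_mul_of_nonneg_right (by exact_mod_cast hT) (h0 _)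
    linarith
  · have e : (∑ j : Fin n, if j.val < k then g j else 0) = ∑ j : Fin n, g j :=
      Finset.sum_congr rfl fun j _ => if_pos (by omega)
    rw [e]
    exact Finset.sum_le_sum_of_subset_of_nonneg (Finset.subset_univ _) fun i _ _ => h0 i

theorem aux_comb {n k q : ℕ} (g : Fin n → ℝ) (hg : Antitone g) (h0 : ∀ i, 0 ≤ g i)
    (A : Fin n → Fin n → ℝ) (hA0 : ∀ i j, 0 ≤ A i j) (hs : ∀ i j, A i j = A j i)
    (hgA : ∀ i j, i ≤ j → g j ≤ A i j)
    (σ : Fin n → Fin n) (hσ : Function.Injective σ) :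
    (∑ u : Fin n, if q ≤ u.val + k ∧ u.val < q + k then g (σ u) else 0) ≤
      (∑ j : Fin n, if j.val < k then g j else 0) +
      ∑ i : Fin n, ∑ j : Fin n,
        if i.val < q ∧ q ≤ j.val ∧ j.val = i.val + k then A (σ i) (σ j) else 0 := by
  classical
  let S : Finset (Fin n) := Finset.univ.filter fun u =>
    (q ≤ u.val + k ∧ u.val < q + k) ∧
    (∀ v : Fin n, (u.val < q ∧ v.val = u.val + k) ∨ (q ≤ u.val ∧ u.val = v.val + k) → σ u < σ v)
  have hScard : S.card ≤ k := by
    have h : S.card ≤ (Finset.Ico q (q + k)).card := by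
      refine Finset.card_le_card_of_injOn
        (fun u : Fin n => if u.val < q then u.val + k else u.val) ?_ ?_
      · intro u hu
        simp only [S, Finset.coe_filter, Finset.mem_univ, true_and, Set.mem_ofPred_eq] at hu
        simp only [Finset.coe_Ico, Set.mem_Ico]
        split_ifs <;> omega
      · intro u hu v hv huv
        simp only [S, Finset.coe_filter, Finset.mem_univ, true_and, Set.mem_ofPred_eq] at hu hv
        have h1 := hu.2 v
        have h2 := hv.2 u
        simp only at huv
        split_ifs at huv with a b b
        · exact Fin.ext (by omega)
        · exact absurd (h1 (Or.inl ⟨a, huv.symm⟩))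
            (not_lt.2 (h2 (Or.inr ⟨not_lt.1 b, huv.symm⟩)).le)
        · exact absurd (h1 (Or.inr ⟨not_lt.1 a, huv⟩))
            (not_lt.2 (h2 (Or.inl ⟨b, huv⟩)).le)
        · exact Fin.ext huv
    simpa using h
  have hS : (∑ u : Fin n, if u ∈ S then g (σ u) else 0) ≤
      ∑ j : Fin n, if j.val < k then g j else 0 := by
    have := aux_top g hg h0 (S.image σ) (Finset.card_image_le.trans hScard)
    rw [Finset.sum_image fun a _ b _ h => hσ h] at this
    rwa [Finset.sum_ite_mem, Finset.univ_inter]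
  let P : Fin n → Fin n → ℝ := fun u v =>
    if (u.val < q ∧ q ≤ v.val ∧ v.val = u.val + k) ∧ σ v < σ u then A (σ u) (σ v) else 0
  let Q : Fin n → Fin n → ℝ := fun u v =>
    if (v.val < q ∧ q ≤ u.val ∧ u.val = v.val + k) ∧ σ v < σ u then A (σ v) (σ u) else 0
  have hP0 : ∀ u v, 0 ≤ P u v := fun u v => by
    simp only [P]; split_ifs <;> simp [hA0]
  have hQ0 : ∀ u v, 0 ≤ Q u v := fun u v => by
    simp only [Q]; split_ifs <;> simp [hA0]
  have hpt : ∀ u : Fin n, (if q ≤ u.val + k ∧ u.val < q + k then g (σ u) else 0) ≤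
      (if u ∈ S then g (σ u) else 0) + ((∑ v, P u v) + ∑ v, Q u v) := by
    intro u
    have hp : 0 ≤ ∑ v, P u v := Finset.sum_nonneg fun v _ => hP0 u v
    have hq : 0 ≤ ∑ v, Q u v := Finset.sum_nonneg fun v _ => hQ0 u v
    by_cases hw : q ≤ u.val + k ∧ u.val < q + k
    · rw [if_pos hw]
      by_cases hu : u ∈ S
      · rw [if_pos hu]; linarith
      · rw [if_neg hu]
        have hu' : ∃ v : Fin n, ((u.val < q ∧ v.val = u.val + k) ∨
            (q ≤ u.val ∧ u.val = v.val + k)) ∧ σ v ≤ σ u := by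
          by_contra hcon
          apply hu
          simp only [S, Finset.mem_filter, Finset.mem_univ, true_and]
          refine ⟨hw, fun v hv => ?_⟩
          by_contra h
          exact hcon ⟨v, hv, not_lt.1 h⟩
        obtain ⟨v, hv, hvu⟩ := hu'
        have hne : σ v ≠ σ u := by
          intro h
          have := congrArg Fin.val (hσ h)
          omega
        have hlt := lt_of_le_of_ne hvu hne
        rcases hv with hv | hv
        · have h1 : P u v ≤ ∑ v, P u v :=
            Finset.single_le_sum (fun v _ => hP0 u v) (Finset.mem_univ v)
          have h2 : P u v = A (σ u) (σ v) := if_pos ⟨⟨hv.1, by omega, hv.2⟩, hlt⟩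
          have h3 := hgA _ _ hvu
          rw [hs] at h3
          linarith
        · have h1 : Q u v ≤ ∑ v, Q u v :=
            Finset.single_le_sum (fun v _ => hQ0 u v) (Finset.mem_univ v)
          have h2 : Q u v = A (σ v) (σ u) := if_pos ⟨⟨by omega, hv.1, hv.2⟩, hlt⟩
          have h3 := hgA _ _ hvu
          linarith
    · rw [if_neg hw]
      have : 0 ≤ if u ∈ S then g (σ u) else 0 := by split_ifs <;> simp [h0]
      linarith
  have hsum := Finset.sum_le_sum fun u (_ : u ∈ Finset.univ) => hpt u
  rw [Finset.sum_add_distrib, Finset.sum_add_distrib,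
    Finset.sum_comm (f := fun u v => Q u v)] at hsum
  have hPQ : (∑ u, ∑ v, P u v) + (∑ v, ∑ u, Q u v) ≤ ∑ i : Fin n, ∑ j : Fin n,
        if i.val < q ∧ q ≤ j.val ∧ j.val = i.val + k then A (σ i) (σ j) else 0 := by
    rw [← Finset.sum_add_distrib]
    refine Finset.sum_le_sum fun i _ => ?_
    rw [← Finset.sum_add_distrib]
    refine Finset.sum_le_sum fun j _ => ?_
    have := hA0 (σ i) (σ j)
    simp only [P, Q]
    by_cases hc : i.val < q ∧ q ≤ j.val ∧ j.val = i.val + k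
    · simp only [hc, true_and]
      rcases lt_trichotomy (σ i) (σ j) with h | h | h
      · simp [h, h.not_gt]
      · simp only [h, lt_self_iff_false, and_false, if_false, add_zero]
        split_ifs <;> simp [hA0]
      · simp [h, h.not_gt]
    · simp [hc]
  linarith

theorem aux_key (k : ℕ) : ∀ (n : ℕ) (A : Fin n → Fin n → ℝ) (_ : ∀ i j, 0 ≤ A i j)
    (_ : ∀ i j, A i j = A j i)
    (_ : ∀ i j l : Fin n, i ≤ j → j ≤ l → A i l ≤ min (A i j) (A j l))
    (π : Fin n → Fin n) (_ : Function.Injective π),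
    (∑ i : Fin n, ∑ j : Fin n, if i.val < j.val ∧ j.val ≤ i.val + k then A (π i) (π j) else 0) ≤
    ∑ i : Fin n, ∑ j : Fin n, if i.val < j.val ∧ j.val ≤ i.val + k then A i j else 0 := by
  intro n
  induction n with
  | zero => intros; simp
  | succ n ih =>
    intro A hA0 hs hR π hπ
    obtain ⟨q, hq⟩ := (Finite.injective_iff_surjective.1 hπ) 0
    have hne : ∀ i : Fin n, π (q.succAbove i) ≠ 0 := fun i h =>
      Fin.succAbove_ne q i (hπ (h.trans hq.symm))
    let σ : Fin n → Fin n := fun i => (π (q.succAbove i)).pred (hne i)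
    have hσs : ∀ i, π (q.succAbove i) = (σ i).succ := fun i => (Fin.succ_pred _ _).symm
    have hσ : Function.Injective σ := by
      intro a b h
      have : π (q.succAbove a) = π (q.succAbove b) := by rw [hσs, hσs, h]
      exact Fin.succAbove_right_injective (hπ this)
    have hsv : ∀ i : Fin n, (q.succAbove i).val = if i.val < q.val then i.val else i.val + 1 := by
      intro i
      by_cases h : i.val < q.val
      · rw [if_pos h, Fin.succAbove_of_castSucc_lt _ _ h]; rfl
      · rw [if_neg h, Fin.succAbove_of_le_castSucc _ _ (by
          rw [Fin.le_def]; exact not_lt.1 h)]; rfl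
    have IH := ih (fun i j => A i.succ j.succ) (fun _ _ => hA0 _ _) (fun _ _ => hs _ _)
      (fun i j l hij hjl => hR _ _ _ (Fin.succ_le_succ_iff.2 hij) (Fin.succ_le_succ_iff.2 hjl))
      σ hσ
    have hc := aux_comb (k := k) (q := q.val) (fun j : Fin n => A 0 j.succ)
      (fun i j hij => (hR 0 i.succ j.succ (Fin.zero_le _)
        (Fin.succ_le_succ_iff.2 hij)).trans (min_le_left _ _))
      (fun _ => hA0 _ _) (fun i j => A i.succ j.succ) (fun _ _ => hA0 _ _) (fun _ _ => hs _ _)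
      (fun i j hij => (hR 0 i.succ j.succ (Fin.zero_le _)
        (Fin.succ_le_succ_iff.2 hij)).trans (min_le_right _ _)) σ hσ
    have hR' : (∑ i : Fin (n+1), ∑ j : Fin (n+1),
        if i.val < j.val ∧ j.val ≤ i.val + k then A i j else 0) =
        (∑ j : Fin n, if j.val < k then A 0 j.succ else 0) +
        ∑ i : Fin n, ∑ j : Fin n,
          if i.val < j.val ∧ j.val ≤ i.val + k then A i.succ j.succ else 0 := by
      rw [Fin.sum_univ_succ, Fin.sum_univ_succ]
      congr 1
      · rw [if_neg (by simp), zero_add]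
        refine Finset.sum_congr rfl fun j _ => if_congr ?_ rfl rfl
        simp only [Fin.val_succ, Fin.val_zero]; omega
      · refine Finset.sum_congr rfl fun i _ => ?_
        rw [Fin.sum_univ_succ, if_neg (by simp), zero_add]
        refine Finset.sum_congr rfl fun j _ => if_congr ?_ rfl rfl
        simp only [Fin.val_succ]; omega
    have hL : (∑ i : Fin (n+1), ∑ j : Fin (n+1),
        if i.val < j.val ∧ j.val ≤ i.val + k then A (π i) (π j) else 0) +
        (∑ i : Fin n, ∑ j : Fin n, if i.val < q.val ∧ q.val ≤ j.val ∧ j.val = i.val + k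
          then A (σ i).succ (σ j).succ else 0) =
        (∑ u : Fin n, if q.val ≤ u.val + k ∧ u.val < q.val + k then A 0 (σ u).succ else 0) +
        ∑ i : Fin n, ∑ j : Fin n,
          if i.val < j.val ∧ j.val ≤ i.val + k then A (σ i).succ (σ j).succ else 0 := by
      rw [Fin.sum_univ_succAbove _ q, Fin.sum_univ_succAbove _ q, if_neg (by simp), zero_add,
        add_assoc, ← Finset.sum_add_distrib, ← Finset.sum_add_distrib, ← Finset.sum_add_distrib]
      refine Finset.sum_congr rfl fun i _ => ?_
      rw [Fin.sum_univ_succAbove _ q, hq, hσs, hs (σ i).succ 0]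
      have e2 : (∑ j : Fin n, if (q.succAbove i).val < (q.succAbove j).val ∧
            (q.succAbove j).val ≤ (q.succAbove i).val + k
            then A (σ i).succ (π (q.succAbove j)) else 0) +
          (∑ j : Fin n, if i.val < q.val ∧ q.val ≤ j.val ∧ j.val = i.val + k
            then A (σ i).succ (σ j).succ else 0) =
          ∑ j : Fin n, if i.val < j.val ∧ j.val ≤ i.val + k
            then A (σ i).succ (σ j).succ else 0 := by
        rw [← Finset.sum_add_distrib]
        refine Finset.sum_congr rfl fun j _ => ?_
        rw [hσs, hsv, hsv]
        split_ifs <;> first | omega | simp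
      rw [add_assoc, e2, ← add_assoc]
      congr 1
      rw [hsv]
      split_ifs <;> first | omega | simp
    rw [hR']
    linarith

theorem aux_key2 (k n : ℕ) (A : Fin n → Fin n → ℝ) (hA0 : ∀ i j, 0 ≤ A i j)
    (hs : ∀ i j, A i j = A j i)
    (hR : ∀ i j l : Fin n, i ≤ j → j ≤ l → A i l ≤ min (A i j) (A j l))
    (π : Equiv.Perm (Fin n)) :
    (∑ i : Fin n, ∑ j : Fin n,
      if ((i.val : ℤ) - j.val).natAbs ≤ k then A (π i) (π j) else 0) ≤
    ∑ i : Fin n, ∑ j : Fin n, if ((i.val : ℤ) - j.val).natAbs ≤ k then A i j else 0 := by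
  have conv : ∀ F : Fin n → Fin n → ℝ, (∀ i j, F i j = F j i) →
      (∑ i : Fin n, ∑ j : Fin n, if ((i.val : ℤ) - j.val).natAbs ≤ k then F i j else 0) =
      (∑ i, F i i) + 2 * ∑ i : Fin n, ∑ j : Fin n,
        if i.val < j.val ∧ j.val ≤ i.val + k then F i j else 0 := by
    intro F hF
    have e1 : (∑ i : Fin n, ∑ j : Fin n, if i.val < j.val ∧ j.val ≤ i.val + k then F i j else 0)
        = ∑ i : Fin n, ∑ j : Fin n, if j.val < i.val ∧ i.val ≤ j.val + k then F i j else 0 := by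
      rw [Finset.sum_comm]
      refine Finset.sum_congr rfl fun i _ => Finset.sum_congr rfl fun j _ => ?_
      rw [hF]
    rw [two_mul]
    nth_rewrite 2 [e1]
    rw [← Finset.sum_add_distrib, ← Finset.sum_add_distrib]
    refine Finset.sum_congr rfl fun i _ => ?_
    have e2 : F i i = ∑ j, if i = j then F i j else 0 := by simp
    rw [e2, ← Finset.sum_add_distrib, ← Finset.sum_add_distrib]
    refine Finset.sum_congr rfl fun j _ => ?_
    simp only [Fin.ext_iff]
    split_ifs <;> first | omega | simp
  rw [conv _ hs, conv (fun i j => A (π i) (π j)) fun i j => hs _ _]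
  have h1 := aux_key k n A hA0 hs hR π π.injective
  have h2 : ∑ i, A (π i) (π i) = ∑ i, A i i := Equiv.sum_comp π fun i => A i i
  linarith

theorem aux_layer (f : ℕ → ℝ) (n d : ℕ) (h : d ≤ n) :
    f d = f n - ∑ k ∈ Finset.range n, (f (k + 1) - f k) * (if d ≤ k then 1 else 0) := by
  induction n, h using Nat.le_induction with
  | base =>
    rw [Finset.sum_eq_zero]
    · simp
    · intro k hk
      rw [if_neg (by have := Finset.mem_range.1 hk; omega), mul_zero]
  | succ m hm ih =>
    rw [Finset.sum_range_succ, if_pos hm]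
    linarith

theorem aux_mono (f : ℕ → ℝ) (hf : Monotone f) (n : ℕ) (A : Fin n → Fin n → ℝ)
    (hA0 : ∀ i j, 0 ≤ A i j) (hs : ∀ i j, A i j = A j i)
    (hR : ∀ i j l : Fin n, i ≤ j → j ≤ l → A i l ≤ min (A i j) (A j l))
    (π : Equiv.Perm (Fin n)) :
    ∑ i : Fin n, ∑ j : Fin n, A i j * f ((i.val : ℤ) - j.val).natAbs ≤
    ∑ i : Fin n, ∑ j : Fin n, A (π i) (π j) * f ((i.val : ℤ) - j.val).natAbs := by
  have conv : ∀ F : Fin n → Fin n → ℝ,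
      ∑ i : Fin n, ∑ j : Fin n, F i j * f ((i.val : ℤ) - j.val).natAbs =
      (∑ i : Fin n, ∑ j : Fin n, F i j) * f n - ∑ k ∈ Finset.range n, (f (k + 1) - f k) *
        ∑ i : Fin n, ∑ j : Fin n, if ((i.val : ℤ) - j.val).natAbs ≤ k then F i j else 0 := by
    intro F
    simp only [Finset.mul_sum, Finset.sum_mul]
    rw [Finset.sum_comm (s := Finset.range n), ← Finset.sum_sub_distrib]
    refine Finset.sum_congr rfl fun i _ => ?_
    rw [Finset.sum_comm (s := Finset.range n), ← Finset.sum_sub_distrib]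
    refine Finset.sum_congr rfl fun j _ => ?_
    rw [aux_layer f n _ (show ((i.val : ℤ) - j.val).natAbs ≤ n by omega), mul_sub,
      Finset.mul_sum]
    congr 1
    refine Finset.sum_congr rfl fun k _ => ?_
    split_ifs <;> ring
  rw [conv A, conv fun i j => A (π i) (π j)]
  have h1 : ∑ i, ∑ j, A (π i) (π j) = ∑ i, ∑ j, A i j := by
    rw [← Equiv.sum_comp π fun i => ∑ j, A i j]
    exact Finset.sum_congr rfl fun i _ => Equiv.sum_comp π fun j => A (π i) j
  rw [h1]
  refine sub_le_sub_left (Finset.sum_le_sum fun k _ => ?_) _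
  exact mul_le_mul_of_nonneg_left (aux_key2 k n A hA0 hs hR π)
    (sub_nonneg.2 (hf (Nat.le_succ k)))

/-- if `A` is a Robinson similarity matrix and `p ≥ 1`, then the identity
permutation is optimal for the p-SUM problem on `A`. -/
theorem identity_optimal_pSum_robinson {n : ℕ}
    (A : Matrix (Fin n) (Fin n) ℝ) (hA : IsRobinsonSim A)
    (p : ℝ) (hp : 1 ≤ p) (π : Equiv.Perm (Fin n)) :
    pSum A p π ≥ pSum A p (1 : Equiv.Perm (Fin n)) := by
  obtain ⟨hs, hR⟩ := hA
  obtain ⟨c, hc⟩ : ∃ c : ℝ, ∀ i j, c ≤ A i j := by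
    obtain ⟨c, hc⟩ := (Set.finite_range fun x : Fin n × Fin n => A x.1 x.2).bddBelow
    exact ⟨c, fun i j => hc ⟨(i, j), rfl⟩⟩
  let f : ℕ → ℝ := fun d => (d : ℝ) ^ p
  have hf : Monotone f := fun a b hab =>
    Real.rpow_le_rpow (Nat.cast_nonneg a) (by exact_mod_cast hab) (by linarith)
  have hfe : ∀ i j : Fin n, |(i.val : ℝ) - (j.val : ℝ)| ^ p = f ((i.val : ℤ) - j.val).natAbs := by
    intro i j
    simp only [f]
    rw [Nat.cast_natAbs]
    push_cast
    rfl
  have h := aux_mono f hf n (fun i j => A i j - c) (fun i j => sub_nonneg.2 (hc i j))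
    (fun i j => by rw [hs i j])
    (fun i j l hij hjl => by
      have := hR i j l hij hjl
      rw [le_min_iff] at this ⊢
      constructor <;> linarith [this.1, this.2]) π
  simp only [sub_mul, Finset.sum_sub_distrib] at h
  simp only [pSum, hfe, Equiv.Perm.coe_one, id_eq]
  linarith
end
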